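/- For every λσ-term t, typing environment Γ and simple type A: if Γ ⊢ t : A in the λσ typing system, then Γ ⊢ Ateb(t) : A; moreover Ateb(t) contains no substitutions. -/

import Mathlib

namespace LambdaSigma

/-- Simple types. -/
inductive Ty : Type
  | base : Ty
  | arrow : Ty → Ty → Ty

mutual
/-- Terms of the λσ-calculus: `one` is the index 1, plus application,
abstraction and closure `t[s]`. -/
inductive Tm : Type
  | one : Tm
  | app : Tm → Tm → Tm
  | lam : Tm → Tm
  | sub : Tm → Sb → Tm

/-- Substitutions of λσ: `id`, `↑`, `t·s` and `s∘s'`. -/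
inductive Sb : Type
  | id : Sb
  | shift : Sb
  | cons : Tm → Sb → Sb
  | comp : Sb → Sb → Sb
end

/-- The de Bruijn index `k+1`, following the convention `n+1 = n[↑]`:
`idx k` is the term representing the index `k+1`. -/
def idx : ℕ → Tm
  | 0 => .one
  | k + 1 => .sub (idx k) .shift

/-- Recognize the terms which are de Bruijn indices: `toIdx? t = some k`
iff `t = idx k` (i.e. `t` is the index `k+1`). -/
def toIdx? : Tm → Option ℕ
  | .one => some 0
  | .sub t .shift => (toIdx? t).map (· + 1)
  | _ => none

mutual
/-- The re-indexing function `⇑ᵢʲ` on terms (indices being treated as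
atomic constants): `⇑ᵢʲ(n) = n+j` if `n > i`, `n` otherwise, homomorphic on
applications, `⇑ᵢʲ(λt) = λ⇑_{i+1}ʲ(t)`, and `⇑ᵢʲ(t[s]) = ⇑_{i'}ʲ(t)[s']`
where `(i',s') = ⇑ᵢʲ(s)`. -/
def upT (i j : ℕ) : Tm → Tm
  | .one => if 0 < i then .one else idx j
  | .app t u => .app (upT i j t) (upT i j u)
  | .lam t => .lam (upT (i + 1) j t)
  | .sub t s =>
      match toIdx? (.sub t s) with
      | some k => if i ≤ k then idx (k + j) else idx k
      | none =>
          let p := upS i j s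
          .sub (upT p.1 j t) p.2

/-- The re-indexing function `⇑ᵢʲ` on substitutions, returning a pair of an
integer and a substitution. -/
def upS (i j : ℕ) : Sb → ℕ × Sb
  | .id => (i, .id)
  | .shift => (i, .shift)
  | .cons t s =>
      let p := upS i j s
      (p.1 + 1, .cons (upT i j t) p.2)
  | .comp s1 s2 =>
      let p2 := upS i j s2
      let p1 := upS p2.1 j s1
      (p1.1, .comp p1.2 p2.2)
end

/-- Substitution-free terms (de Bruijn indices being treated as atomic
constants containing no substitutions). -/
inductive Pure : Tm → Prop
  | idx (n : ℕ) : Pure (idx n)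
  | app {t u : Tm} : Pure t → Pure u → Pure (.app t u)
  | lam {t : Tm} : Pure t → Pure (.lam t)

mutual
/-- The simple typing system of λσ: `TypT Γ t A` is `Γ ⊢ t : A`. -/
inductive TypT : List Ty → Tm → Ty → Prop
  | one {Γ : List Ty} {A : Ty} : TypT (A :: Γ) .one A
  | app {Γ : List Ty} {t u : Tm} {A B : Ty} :
      TypT Γ t (.arrow B A) → TypT Γ u B → TypT Γ (.app t u) A
  | lam {Γ : List Ty} {t : Tm} {A B : Ty} :
      TypT (B :: Γ) t A → TypT Γ (.lam t) (.arrow B A)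
  | sub {Γ Γ' : List Ty} {t : Tm} {s : Sb} {A : Ty} :
      TypS Γ s Γ' → TypT Γ' t A → TypT Γ (.sub t s) A

/-- Typing of substitutions: `TypS Γ s Γ'` is `Γ ⊢ s ▷ Γ'`. -/
inductive TypS : List Ty → Sb → List Ty → Prop
  | id {Γ : List Ty} : TypS Γ .id Γ
  | shift {Γ : List Ty} {A : Ty} : TypS (A :: Γ) .shift Γ
  | cons {Γ Γ' : List Ty} {t : Tm} {s : Sb} {A : Ty} :
      TypT Γ t A → TypS Γ s Γ' → TypS Γ (.cons t s) (A :: Γ')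
  | comp {Γ Γ' Γ'' : List Ty} {s s' : Sb} :
      TypS Γ s' Γ'' → TypS Γ'' s Γ' → TypS Γ (.comp s s') Γ'
end

-- Sizes used to define `Ateb` by well-founded recursion.
mutual
def szT : Tm → ℕ
  | .one => 1
  | .app t u => szT t + szT u + 1
  | .lam t => szT t + 1
  | .sub t s => szT t + szS s + 1
def szS : Sb → ℕ
  | .id => 1
  | .shift => 1
  | .cons t s => szT t + szS s + 1
  | .comp s s' => szS s + szS s' + 2
end

theorem szT_pos : ∀ t : Tm, 0 < szT t := by
  intro t; cases t <;> simp [szT]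

/-- The expansion `Ateb` from λσ-terms to substitution-free terms. -/
def Ateb : Tm → Tm
  | .one => .one
  | .app t u => .app (Ateb t) (Ateb u)
  | .lam t => .lam (Ateb t)
  | .sub t .id => Ateb t
  | .sub t .shift => upT 0 1 (Ateb t)
  | .sub t (.comp s s') => Ateb (.sub (.sub t s) s')
  | .sub t (.cons t' s) => .app (Ateb (.sub (.lam t) s)) (Ateb t')
termination_by t => szT t
decreasing_by
  all_goals simp [szT, szS]
  all_goals first
    | omega
    | (have := szT_pos t'; omega)

mutual
/-- The σ-rules of λσ on terms (all the rules except `B`), closed under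
arbitrary contexts. -/
inductive SStep : Tm → Tm → Prop
  | app_s {t u : Tm} {s : Sb} :
      SStep (.sub (.app t u) s) (.app (.sub t s) (.sub u s))
  | lam_s {t : Tm} {s : Sb} :
      SStep (.sub (.lam t) s) (.lam (.sub t (.cons .one (.comp s .shift))))
  | varid : SStep (.sub .one .id) .one
  | varcons {t : Tm} {s : Sb} : SStep (.sub .one (.cons t s)) t
  | clos {t : Tm} {s s' : Sb} : SStep (.sub (.sub t s) s') (.sub t (.comp s s'))
  | appl {t t' u : Tm} : SStep t t' → SStep (.app t u) (.app t' u)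
  | appr {t u u' : Tm} : SStep u u' → SStep (.app t u) (.app t u')
  | lam {t t' : Tm} : SStep t t' → SStep (.lam t) (.lam t')
  | subt {t t' : Tm} {s : Sb} : SStep t t' → SStep (.sub t s) (.sub t' s)
  | subs {t : Tm} {s s' : Sb} : SStepS s s' → SStep (.sub t s) (.sub t s')

/-- The σ-rules on substitutions. -/
inductive SStepS : Sb → Sb → Prop
  | idl {s : Sb} : SStepS (.comp .id s) s
  | shiftid : SStepS (.comp .shift .id) .shift
  | shiftcons {t : Tm} {s : Sb} : SStepS (.comp .shift (.cons t s)) s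
  | mapr {t : Tm} {s s' : Sb} :
      SStepS (.comp (.cons t s) s') (.cons (.sub t s') (.comp s s'))
  | assoc {s1 s2 s3 : Sb} :
      SStepS (.comp (.comp s1 s2) s3) (.comp s1 (.comp s2 s3))
  | consl {t t' : Tm} {s : Sb} : SStep t t' → SStepS (.cons t s) (.cons t' s)
  | consr {t : Tm} {s s' : Sb} : SStepS s s' → SStepS (.cons t s) (.cons t s')
  | compl {s1 s1' s2 : Sb} : SStepS s1 s1' → SStepS (.comp s1 s2) (.comp s1' s2)
  | compr {s1 s2 s2' : Sb} : SStepS s2 s2' → SStepS (.comp s1 s2) (.comp s1 s2')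
end

mutual
/-- The rule `B` of λσ, closed under arbitrary contexts. -/
inductive BStep : Tm → Tm → Prop
  | beta {t u : Tm} : BStep (.app (.lam t) u) (.sub t (.cons u .id))
  | appl {t t' u : Tm} : BStep t t' → BStep (.app t u) (.app t' u)
  | appr {t u u' : Tm} : BStep u u' → BStep (.app t u) (.app t u')
  | lam {t t' : Tm} : BStep t t' → BStep (.lam t) (.lam t')
  | subt {t t' : Tm} {s : Sb} : BStep t t' → BStep (.sub t s) (.sub t' s)
  | subs {t : Tm} {s s' : Sb} : BStepS s s' → BStep (.sub t s) (.sub t s')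

/-- The rule `B` inside substitutions. -/
inductive BStepS : Sb → Sb → Prop
  | consl {t t' : Tm} {s : Sb} : BStep t t' → BStepS (.cons t s) (.cons t' s)
  | consr {t : Tm} {s s' : Sb} : BStepS s s' → BStepS (.cons t s) (.cons t s')
  | compl {s1 s1' s2 : Sb} : BStepS s1 s1' → BStepS (.comp s1 s2) (.comp s1' s2)
  | compr {s1 s2 s2' : Sb} : BStepS s2 s2' → BStepS (.comp s1 s2) (.comp s1 s2')
end

/-- The full λσ-reduction on terms: the union of `B` and the σ-rules. -/
def Step (t u : Tm) : Prop := BStep t u ∨ SStep t u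

/-- A term is in σ-normal form. -/
def SNormT (t : Tm) : Prop := ∀ u : Tm, ¬ SStep t u

/-- A substitution is in σ-normal form. -/
def SNormS (s : Sb) : Prop := ∀ s' : Sb, ¬ SStepS s s'

/-- `σ(t) = σ(u)` : the terms `t` and `u` have the same σ-normal form
(the σ-calculus being strongly normalizing and confluent, this is expressed
by the existence of a common σ-reduct in σ-normal form). -/
def EqSNF (t u : Tm) : Prop :=
  ∃ v : Tm, Relation.ReflTransGen SStep t v ∧
    Relation.ReflTransGen SStep u v ∧ SNormT v

mutual
/-- Potential redexability of terms: `prT t = true` iff `t` contains an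
application or a `λ` at some node. -/
def prT : Tm → Bool
  | .one => false
  | .app _ _ => true
  | .lam _ => true
  | .sub t s => prT t || prS s

/-- Potential redexability of substitutions. -/
def prS : Sb → Bool
  | .id => false
  | .shift => false
  | .cons t s => prT t || prS s
  | .comp s s' => prS s || prS s'
end

mutual
/-- The relation `≼` on terms. -/
inductive PrecT : Tm → Tm → Prop
  | idx (n m : ℕ) : PrecT (idx n) (idx m)
  | app {t t' u u' : Tm} : PrecT t t' → PrecT u u' → PrecT (.app t u) (.app t' u')
  | lam {t t' : Tm} : PrecT t t' → PrecT (.lam t) (.lam t')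
  | sub_r {t t' : Tm} {s : Sb} :
      PrecT t t' → prS s = false → PrecT t (.sub t' s)
  | sub {t t' : Tm} {s s' : Sb} :
      PrecT t t' → PrecS s s' → PrecT (.sub t s) (.sub t' s')

/-- The relation `≼` on substitutions. -/
inductive PrecS : Sb → Sb → Prop
  | shift : PrecS .shift .shift
  | id : PrecS .id .id
  | id_r {s : Sb} : prS s = false → PrecS .id s
  | cons {t t' : Tm} {s s' : Sb} :
      PrecT t t' → PrecS s s' → PrecS (.cons t s) (.cons t' s')
  | comp_r1 {s s' s1 : Sb} :
      PrecS s s' → prS s1 = false → PrecS s (.comp s' s1)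
  | comp_r2 {s s' s1 : Sb} :
      PrecS s s' → prS s1 = false → PrecS s (.comp s1 s')
  | comp {s1 s1' s2 s2' : Sb} :
      PrecS s1 s1' → PrecS s2 s2' → PrecS (.comp s1 s2) (.comp s1' s2')
end

/-- The relation `⋖` : `u ⋖ t` iff `u ≼ t` and `σ(u) = σ(t)`. -/
def Lessdot (u t : Tm) : Prop := PrecT u t ∧ EqSNF u t

/-- `⇑(s) = 1·(s∘↑)`. -/
def liftS (s : Sb) : Sb := .cons .one (.comp s .shift)

mutual
/-- Terms containing no `↑` (outside of de Bruijn indices, which are treated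
as atomic constants). -/
inductive NoShiftT : Tm → Prop
  | idx (n : ℕ) : NoShiftT (idx n)
  | app {t u : Tm} : NoShiftT t → NoShiftT u → NoShiftT (.app t u)
  | lam {t : Tm} : NoShiftT t → NoShiftT (.lam t)
  | sub {t : Tm} {s : Sb} : NoShiftT t → NoShiftS s → NoShiftT (.sub t s)

/-- Substitutions containing no `↑`. -/
inductive NoShiftS : Sb → Prop
  | id : NoShiftS .id
  | cons {t : Tm} {s : Sb} : NoShiftT t → NoShiftS s → NoShiftS (.cons t s)
  | comp {s s' : Sb} : NoShiftS s → NoShiftS s' → NoShiftS (.comp s s')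
end

theorem toIdx?_idx (k : ℕ) : toIdx? (idx k) = some k := by
  induction k with
  | zero => simp [idx, toIdx?]
  | succ k ih => simp [idx, toIdx?, ih]

theorem upT_idx (i j k : ℕ) :
    upT i j (idx k) = if i ≤ k then idx (k + j) else idx k := by
  cases k with
  | zero =>
    rcases Nat.eq_zero_or_pos i with rfl | hi
    · simp [idx, upT]
    · simp [idx, upT, hi, Nat.not_le.mpr hi]
  | succ k =>
    have h : toIdx? (.sub (idx k) .shift) = some (k + 1) := toIdx?_idx (k + 1)
    rw [idx, upT, h]
    simp only [idx]

/-- The index `k+1` has exactly the type at position `k` in the environment. -/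
theorem typT_idx_iff {Γ : List Ty} {k : ℕ} {A : Ty} :
    TypT Γ (idx k) A ↔ Γ[k]? = some A := by
  induction k generalizing Γ with
  | zero =>
    constructor
    · intro h
      cases h
      rfl
    · intro h
      cases Γ with
      | nil => simp at h
      | cons B Γ =>
        obtain rfl : B = A := by simpa using h
        exact .one
  | succ k ih =>
    constructor
    · intro h
      cases h with
      | sub hs ht =>
        cases hs
        simpa using ih.mp ht
    · intro h
      cases Γ with
      | nil => simp at h
      | cons B Γ => exact .sub .shift (ih.mpr (by simpa using h))

theorem Pure.upT {t : Tm} (ht : Pure t) (i j : ℕ) : Pure (upT i j t) := by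
  induction ht generalizing i with
  | idx n =>
    rw [upT_idx]
    split <;> exact .idx _
  | app _ _ iht ihu => simpa only [LambdaSigma.upT] using (iht i).app (ihu i)
  | lam _ ih => simpa only [LambdaSigma.upT] using (ih (i + 1)).lam

/-- Weakening: re-indexing a substitution-free term inserts an environment `Θ`
below the first `Δ.length` entries. -/
theorem TypT.upT {t : Tm} (ht : Pure t) {Δ Γ : List Ty} {A : Ty} (Θ : List Ty)
    (h : TypT (Δ ++ Γ) t A) :
    TypT (Δ ++ (Θ ++ Γ)) (upT Δ.length Θ.length t) A := by
  induction ht generalizing Δ A with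
  | idx n =>
    rw [typT_idx_iff] at h
    rw [upT_idx]
    split_ifs with hn
    · rw [typT_idx_iff, List.getElem?_append_right (by omega),
        List.getElem?_append_right (by omega)]
      rw [List.getElem?_append_right hn] at h
      rwa [show n + Θ.length - Δ.length - Θ.length = n - Δ.length by omega]
    · rw [typT_idx_iff, List.getElem?_append_left (by omega)]
      rwa [List.getElem?_append_left (by omega)] at h
  | app _ _ iht ihu =>
    generalize hΞ : Δ ++ Γ = Ξ at h
    cases h with
    | app h₁ h₂ =>
      subst hΞ
      rw [LambdaSigma.upT]
      exact .app (iht h₁) (ihu h₂)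
  | lam _ ih =>
    generalize hΞ : Δ ++ Γ = Ξ at h
    cases h with
    | @lam _ _ _ B h =>
      subst hΞ
      rw [LambdaSigma.upT]
      exact .lam (ih (Δ := B :: Δ) h)

theorem pure_Ateb (t : Tm) : Pure (Ateb t) := by
  induction t using Ateb.induct with
  | case1 => simpa only [Ateb, idx] using Pure.idx 0
  | case2 t u iht ihu => simpa only [Ateb] using iht.app ihu
  | case3 t ih => simpa only [Ateb] using ih.lam
  | case4 t ih => simpa only [Ateb] using ih
  | case5 t ih => simpa only [Ateb] using ih.upT 0 1
  | case6 t s s' ih => simpa only [Ateb] using ih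
  | case7 t t' s ih ih' => simpa only [Ateb] using ih.app ih'

theorem TypT.Ateb {Γ : List Ty} {t : Tm} {A : Ty} (h : TypT Γ t A) :
    TypT Γ (Ateb t) A := by
  induction t using Ateb.induct generalizing Γ A with
  | case1 => simpa only [LambdaSigma.Ateb] using h
  | case2 t u iht ihu =>
    cases h with
    | app h₁ h₂ => simpa only [LambdaSigma.Ateb] using (iht h₁).app (ihu h₂)
  | case3 t ih =>
    cases h with
    | lam h => simpa only [LambdaSigma.Ateb] using (ih h).lam
  | case4 t ih =>
    cases h with
    | sub hs ht =>
      cases hs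
      simpa only [LambdaSigma.Ateb] using ih ht
  | case5 t ih =>
    cases h with
    | sub hs ht =>
      cases hs with
      | @shift _ B =>
        rw [LambdaSigma.Ateb]
        exact TypT.upT (pure_Ateb t) (Δ := []) [B] (ih ht)
  | case6 t s s' ih =>
    cases h with
    | sub hs ht =>
      cases hs with
      | comp hs' hs => simpa only [LambdaSigma.Ateb] using ih (.sub hs' (.sub hs ht))
  | case7 t t' s ih ih' =>
    cases h with
    | sub hs ht =>
      cases hs with
      | cons ht' hs =>
        simpa only [LambdaSigma.Ateb] using (ih (.sub hs (.lam ht))).app (ih' ht')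

/-- If `Γ ⊢ t : A` in λσ then `Γ ⊢ Ateb t : A`, and `Ateb t` contains no
substitutions. -/
theorem Ateb_typing :
    ∀ (Γ : List Ty) (t : Tm) (A : Ty), TypT Γ t A →
      TypT Γ (Ateb t) A ∧ Pure (Ateb t) := by
  exact fun _ t _ h => ⟨h.Ateb, pure_Ateb t⟩

end LambdaSigma
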